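/- arXiv:2503.16306 — 2 statements merged into one kernel-verified Lean document; each statement's English description precedes it below -/
import Mathlib

section
/- For a rational number x, let Δ(x) be the five-sided die with faces {x, 5, 3, −9, −x+1}, and define the tilt T(Y) = P(Y > 0) − P(Y < 0) for a random variable Y with mean 0. Then for every positive integer k and all rationals x, x' with x > 9k and x' > 9k, T(Δ(x)[k]) = T(Δ(x')[k]); that is, the tilt of the sum of k rolls of Δ(x) is constant in x on the region x > 9k. -/
-- The probability of an event `p` under the uniform distribution on a finite
-- sample space `Ω`, as a rational number.
open Classical in
noncomputable def prob {Ω : Type*} [Fintype Ω] (p : Ω → Prop) : ℚ :=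
  ((Finset.univ.filter p).card : ℚ) / (Fintype.card Ω : ℚ)

/-- The sum of the face values of a die `D` (a function from a finite index type
of faces to rational values) along a sequence of `k` rolls `f`. -/
def sumRolls {ι : Type*} (D : ι → ℚ) {k : ℕ} (f : Fin k → ι) : ℚ :=
  ∑ i, D (f i)

/-- `Beats A B k` : after summing `k` independent uniform rolls of each die,
`A` is strictly more likely to show the larger total than `B`. -/
def Beats {ι κ : Type*} [Fintype ι] [Fintype κ] (A : ι → ℚ) (B : κ → ℚ) (k : ℕ) : Prop :=
  prob (fun p : (Fin k → ι) × (Fin k → κ) => sumRolls B p.2 < sumRolls A p.1) >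
    prob (fun p : (Fin k → ι) × (Fin k → κ) => sumRolls A p.1 < sumRolls B p.2)

/-- The parametrized five-sided die `Δ(x)` with faces `{x, 5, 3, −9, −x+1}`. -/
def Delta (x : ℚ) : Fin 5 → ℚ := ![x, 5, 3, -9, -x + 1]

/-- The tilt of the sum of `k` rolls of the mean-zero die `Δ(x)`:
`T(Δ(x)[k]) = P(Δ(x)[k] > 0) − P(Δ(x)[k] < 0)`. -/
noncomputable def tiltDelta (x : ℚ) (k : ℕ) : ℚ :=
  prob (fun f : Fin k → Fin 5 => 0 < sumRolls (Delta x) f) -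
    prob (fun f : Fin k → Fin 5 => sumRolls (Delta x) f < 0)

/-- The coefficients of `x` in the faces of `Δ(x)`. -/
def faceSlope : Fin 5 → ℤ := ![1, 0, 0, 0, -1]

/-- The constant terms of the faces of `Δ(x)`. -/
def faceConst : Fin 5 → ℚ := ![0, 5, 3, -9, 1]

lemma Delta_apply (x : ℚ) (i : Fin 5) : Delta x i = faceSlope i * x + faceConst i := by
  fin_cases i <;> simp [Delta, faceSlope, faceConst]

lemma abs_faceConst_le (i : Fin 5) : |faceConst i| ≤ 9 := by
  fin_cases i <;> norm_num [faceConst, abs_le]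

lemma sumRolls_Delta (x : ℚ) {k : ℕ} (f : Fin k → Fin 5) :
    sumRolls (Delta x) f = (∑ i, faceSlope (f i) : ℤ) * x + sumRolls faceConst f := by
  simp [sumRolls, Delta_apply, Finset.sum_add_distrib, Finset.sum_mul]

lemma abs_sumRolls_faceConst_le {k : ℕ} (f : Fin k → Fin 5) :
    |sumRolls faceConst f| ≤ 9 * k := by
  calc |sumRolls faceConst f| ≤ ∑ i, |faceConst (f i)| := Finset.abs_sum_le_sum_abs _ _
    _ ≤ ∑ _i : Fin k, (9 : ℚ) := Finset.sum_le_sum fun i _ => abs_faceConst_le _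
    _ = 9 * k := by simp [mul_comm]

/-- When `x` dominates `r`, the sign of `c * x + r` for an integer `c` is that of the pair
`(c, r)` in the lexicographic order. -/
lemma int_mul_add_pos_iff (c : ℤ) {r x : ℚ} (h : |r| < x) :
    0 < c * x + r ↔ 0 < c ∨ c = 0 ∧ 0 < r := by
  obtain ⟨h₁, h₂⟩ := abs_lt.mp h
  rcases lt_trichotomy c 0 with hc | rfl | hc
  · have hc' : (c : ℚ) ≤ -1 := by exact_mod_cast Int.le_sub_one_of_lt hc
    have : ¬ 0 < c * x + r := by nlinarith
    simp [this, hc.not_gt, hc.ne]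
  · simp
  · have hc' : (1 : ℚ) ≤ c := by exact_mod_cast hc
    have : 0 < c * x + r := by nlinarith
    simp [this, hc]

lemma int_mul_add_neg_iff (c : ℤ) {r x : ℚ} (h : |r| < x) :
    c * x + r < 0 ↔ c < 0 ∨ c = 0 ∧ r < 0 := by
  have := int_mul_add_pos_iff (-c) (r := -r) (x := x) (by rwa [abs_neg])
  rw [← neg_pos, neg_add, ← neg_mul, ← Int.cast_neg, this]
  simp

/-- The tilt of `Δ(x)[k]` is constant in `x` on the region `x > 9k`: for any
`x, x' > 9k`, `T(Δ(x)[k]) = T(Δ(x')[k])`. -/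
theorem tilt_constant_beyond_9k (k : ℕ) (hk : 0 < k) (x x' : ℚ)
    (hx : x > 9 * k) (hx' : x' > 9 * k) :
    tiltDelta x k = tiltDelta x' k := by
  have h (f : Fin k → Fin 5) := (abs_sumRolls_faceConst_le f).trans_lt hx
  have h' (f : Fin k → Fin 5) := (abs_sumRolls_faceConst_le f).trans_lt hx'
  simp only [tiltDelta, sumRolls_Delta, int_mul_add_pos_iff _ (h _), int_mul_add_pos_iff _ (h' _),
    int_mul_add_neg_iff _ (h _), int_mul_add_neg_iff _ (h' _)]
end

section
/- For a rational number x, let Δ(x) be the five-sided die with faces {x, 5, 3, −9, −x+1}. Suppose that for some positive integer k_0 and some rational x_0 > 9·k_0 we have P(Δ(x_0)[k] > 0) > P(Δ(x_0)[k] < 0) for all 1 ≤ k ≤ k_0. Then for every rational x > 9·k_0, P(Δ(x)[k] > 0) > P(Δ(x)[k] < 0) for all 1 ≤ k ≤ k_0; in particular, the first inversion time of Δ(x) against the one-sided die {0} is greater than k_0 for every x > 9·k_0. -/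
/-- If `x` and `y` both dominate `|r|`, then `d * x + r` and `d * y + r` have the same sign
for every integer `d`. -/
lemma sign_int_mul_add_eq (d : ℤ) {r x y : ℚ} (hx : |r| < x) (hy : |r| < y) :
    SignType.sign ((d : ℚ) * x + r) = SignType.sign ((d : ℚ) * y + r) := by
  have hr := abs_le.mp (le_refl |r|)
  have hr0 := abs_nonneg r
  rcases lt_trichotomy d 0 with hd | rfl | hd
  · have hd' : (d : ℚ) ≤ -1 := by exact_mod_cast (by omega : d ≤ -1)
    rw [sign_neg (by nlinarith), sign_neg (by nlinarith)]
  · simp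
  · have hd' : (1 : ℚ) ≤ d := by exact_mod_cast hd
    rw [sign_pos (by nlinarith), sign_pos (by nlinarith)]

/-- The total of `k` rolls of `Δ(x)` is affine in `x`, with an integer slope and a constant term
of size at most `9 * k`, both independent of `x`. -/
lemma exists_sumRolls_Delta_eq {k : ℕ} (f : Fin k → Fin 5) :
    ∃ (d : ℤ) (r : ℚ), |r| ≤ 9 * k ∧ ∀ x, sumRolls (Delta x) f = d * x + r := by
  refine ⟨∑ i, ![1, 0, 0, 0, -1] (f i), ∑ i, ![0, 5, 3, -9, 1] (f i), ?_, fun x => ?_⟩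
  · have hface : ∀ j : Fin 5, |(![0, 5, 3, -9, 1] : Fin 5 → ℚ) j| ≤ 9 := by
      intro j
      fin_cases j <;> norm_num [abs_of_pos]
    calc |∑ i, (![0, 5, 3, -9, 1] : Fin 5 → ℚ) (f i)|
        ≤ ∑ i, |(![0, 5, 3, -9, 1] : Fin 5 → ℚ) (f i)| := Finset.abs_sum_le_sum_abs _ _
      _ ≤ ∑ _i : Fin k, (9 : ℚ) := Finset.sum_le_sum fun i _ => hface (f i)
      _ = 9 * k := by simp [mul_comm]
  · have hface : ∀ j : Fin 5, Delta x j =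
        ((![1, 0, 0, 0, -1] : Fin 5 → ℤ) j : ℚ) * x + (![0, 5, 3, -9, 1] : Fin 5 → ℚ) j := by
      intro j
      fin_cases j <;> simp [Delta]
    simp only [sumRolls, hface, Finset.sum_add_distrib, Finset.sum_mul, Int.cast_sum]

lemma sign_sumRolls_Delta_eq {k : ℕ} (f : Fin k → Fin 5) {x y : ℚ} (hx : 9 * (k : ℚ) < x)
    (hy : 9 * (k : ℚ) < y) :
    SignType.sign (sumRolls (Delta x) f) = SignType.sign (sumRolls (Delta y) f) := by
  obtain ⟨d, r, hr, hf⟩ := exists_sumRolls_Delta_eq f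
  rw [hf, hf]
  exact sign_int_mul_add_eq d (hr.trans_lt hx) (hr.trans_lt hy)

/-- If for some `k₀ ≥ 1` and some `x₀ > 9k₀` the die `Δ(x₀)` beats the
one-sided die `{0}` after every number of rolls `k` with `1 ≤ k ≤ k₀`, then for
every `x > 9k₀` the die `Δ(x)` beats `{0}` after every `k` with `1 ≤ k ≤ k₀`;
in particular the first inversion time of `Δ(x)` exceeds `k₀` for all
`x > 9k₀`. -/
theorem late_inversion_uniform (k0 : ℕ) (hk0 : 0 < k0) (x0 : ℚ) (hx0 : x0 > 9 * k0)
    (h : ∀ k : ℕ, 1 ≤ k → k ≤ k0 →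
      prob (fun f : Fin k → Fin 5 => 0 < sumRolls (Delta x0) f) >
        prob (fun f : Fin k → Fin 5 => sumRolls (Delta x0) f < 0)) :
    ∀ x : ℚ, x > 9 * k0 → ∀ k : ℕ, 1 ≤ k → k ≤ k0 →
      prob (fun f : Fin k → Fin 5 => 0 < sumRolls (Delta x) f) >
        prob (fun f : Fin k → Fin 5 => sumRolls (Delta x) f < 0) := by
  intro x hx k hk hkk
  have hk9 : 9 * (k : ℚ) ≤ 9 * k0 := by gcongr
  have hsign (f : Fin k → Fin 5) :=
    sign_sumRolls_Delta_eq f (hk9.trans_lt hx) (hk9.trans_lt hx0)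
  simpa only [← sign_eq_one_iff, ← sign_eq_neg_one_iff, hsign] using h k hk hkk
end
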